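/- Fix η ∈ (0, 1/2). Let d > 2^{1/η} be an integer, let γ ∈ (0, η − log 2 / log d], let N ≥ 1 be an integer, and let a ∈ W be a point with dist_d(a, c) ≥ d^{γ−η}, where c = (N/2, …, N/2) is the center of the hypercube. Then the proportion of vertices v ∈ V with |cos θ_v| ≤ (√2 + 1)·d^{−γ} is at least 1 − 1/d^{1−2η}, where θ_v is the angle at c between the segments from c to a and from c to v. -/

import Mathlib

/-- Euclidean distance between two points of `ℝ^d`. -/
noncomputable def dE {d : ℕ} (x y : Fin d → ℝ) : ℝ :=
  Real.sqrt (∑ i, (x i - y i) ^ 2)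

/-- Normalized distance `dist(x,y)/(√d · N)`. -/
noncomputable def dn (d N : ℕ) (x y : Fin d → ℝ) : ℝ :=
  dE x y / (Real.sqrt d * N)

/-- The lattice points `{0,1,…,N}^d` of the hypercube `[0,N]^d`. -/
noncomputable def cubeW (d N : ℕ) : Finset (Fin d → ℝ) :=
  Finset.image (fun f : Fin d → Fin (N + 1) => fun i => (f i : ℝ)) Finset.univ

/-- The `2^d` vertices `{0,N}^d` of the hypercube `[0,N]^d`. -/
noncomputable def cubeV (d N : ℕ) : Finset (Fin d → ℝ) :=
  Finset.image (fun f : Fin d → Bool => fun i => if f i then (N : ℝ) else 0) Finset.univ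

/-- The center `(N/2, …, N/2)` of the hypercube `[0,N]^d`. -/
noncomputable def ctr (d N : ℕ) : Fin d → ℝ := fun _ => (N : ℝ) / 2

/-- Average of squared Euclidean distances from `a` to the vertices. -/
noncomputable def A_V (d N : ℕ) (a : Fin d → ℝ) : ℝ :=
  (∑ v ∈ cubeV d N, dE v a ^ 2) / 2 ^ d

/-- Normalized average of squared distances from `a` to the vertices. -/
noncomputable def B_V (d N : ℕ) (a : Fin d → ℝ) : ℝ :=
  A_V d N a / (d * (N : ℝ) ^ 2)

/-- Average of squared Euclidean distances from `a` to the lattice points. -/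
noncomputable def A_W (d N : ℕ) (a : Fin d → ℝ) : ℝ :=
  (∑ w ∈ cubeW d N, dE w a ^ 2) / ((N : ℝ) + 1) ^ d

/-- Normalized average of squared distances from `a` to the lattice points. -/
noncomputable def B_W (d N : ℕ) (a : Fin d → ℝ) : ℝ :=
  A_W d N a / (d * (N : ℝ) ^ 2)

open Classical in
/-- Number of elements of a finite set satisfying a predicate. -/
noncomputable def pcount {α : Type*} (s : Finset α) (p : α → Prop) : ℕ :=
  (s.filter p).card

open Classical in
/-- Ordered pairs of vertices forming a non-degenerate triangle with `a`. -/
noncomputable def TaV (d N : ℕ) (a : Fin d → ℝ) : Finset ((Fin d → ℝ) × (Fin d → ℝ)) :=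
  ((cubeV d N) ×ˢ (cubeV d N)).filter (fun p => a ≠ p.1 ∧ a ≠ p.2 ∧ p.1 ≠ p.2)

open Classical in
/-- Ordered pairs of lattice points forming a non-degenerate triangle with `a`. -/
noncomputable def TaW (d N : ℕ) (a : Fin d → ℝ) : Finset ((Fin d → ℝ) × (Fin d → ℝ)) :=
  ((cubeW d N) ×ˢ (cubeW d N)).filter (fun p => a ≠ p.1 ∧ a ≠ p.2 ∧ p.1 ≠ p.2)

/-- Cosine of the angle at `c` in the triangle `(a, c, v)`. -/
noncomputable def cosAngleAt {d : ℕ} (c a v : Fin d → ℝ) : ℝ :=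
  (∑ i, (a i - c i) * (v i - c i)) / (dE a c * dE v c)

/-- The sign `1` or `-1` attached to a Boolean. -/
def boolSign (b : Bool) : ℝ := if b then 1 else -1

theorem boolSign_not (b : Bool) : boolSign (!b) = -boolSign b := by
  cases b <;> simp [boolSign]

theorem boolSign_mul_self (b : Bool) : boolSign b * boolSign b = 1 := by
  cases b <;> simp [boolSign]

/-- Distinct Rademacher coordinates are orthogonal. -/
theorem sum_boolSign_mul_boolSign {ι : Type*} [Fintype ι] [DecidableEq ι] {i j : ι}
    (hij : i ≠ j) : ∑ f : ι → Bool, boolSign (f i) * boolSign (f j) = 0 := by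
  have hinv : Function.Involutive
      (fun (f : ι → Bool) => Function.update f i (!f i)) := by
    intro f
    simp
  have h := Equiv.sum_comp hinv.toPerm
    (fun f : ι → Bool => boolSign (f i) * boolSign (f j))
  simp only [Function.Involutive.coe_toPerm, Function.update_self,
    Function.update_of_ne hij.symm, boolSign_not, neg_mul, Finset.sum_neg_distrib] at h
  linarith

/-- The second moment of a Rademacher sum. -/
theorem sum_sq_sum_mul_boolSign {ι : Type*} [Fintype ι] [DecidableEq ι] (x : ι → ℝ) :
    ∑ f : ι → Bool, (∑ i, x i * boolSign (f i)) ^ 2 =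
      2 ^ Fintype.card ι * ∑ i, x i ^ 2 := by
  simp_rw [sq (∑ i, x i * boolSign _), Finset.sum_mul_sum]
  rw [Finset.sum_comm, Finset.mul_sum]
  refine Finset.sum_congr rfl fun i _ => ?_
  rw [Finset.sum_comm, Finset.sum_eq_single i]
  · simp_rw [mul_mul_mul_comm, boolSign_mul_self]
    simp [sq]
  · intro j _ hji
    simp_rw [mul_mul_mul_comm]
    rw [← Finset.mul_sum, sum_boolSign_mul_boolSign hji.symm, mul_zero]
  · simp

theorem cubeV_map_injective (d : ℕ) {N : ℕ} (hN : 1 ≤ N) : Function.Injective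
    (fun (f : Fin d → Bool) (i : Fin d) => if f i then (N : ℝ) else 0) := by
  have hN' : (N : ℝ) ≠ 0 := by positivity
  intro f g h
  funext i
  have hi := congrFun h i
  cases hf : f i <;> cases hg : g i <;> simp [hf, hg, hN', hN'.symm] at hi <;> rfl

theorem card_cubeV (d : ℕ) {N : ℕ} (hN : 1 ≤ N) : (cubeV d N).card = 2 ^ d := by
  rw [cubeV, Finset.card_image_of_injective _ (cubeV_map_injective d hN)]
  simp

theorem vertex_sub_ctr {d : ℕ} (N : ℕ) (f : Fin d → Bool) (i : Fin d) :
    (if f i then (N : ℝ) else 0) - ctr d N i = boolSign (f i) * (N / 2) := by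
  cases f i <;> simp [boolSign, ctr]
  ring

theorem dE_vertex_ctr_sq {d : ℕ} (N : ℕ) (f : Fin d → Bool) :
    dE (fun i => if f i then (N : ℝ) else 0) (ctr d N) ^ 2 = d * (N / 2 : ℝ) ^ 2 := by
  rw [dE, Real.sq_sqrt (Finset.sum_nonneg fun _ _ => sq_nonneg _)]
  simp_rw [vertex_sub_ctr, mul_pow, sq (boolSign _), boolSign_mul_self]
  simp

theorem cosAngleAt_vertex_sq {d N : ℕ} (hN : 1 ≤ N) (a : Fin d → ℝ) (f : Fin d → Bool) :
    cosAngleAt (ctr d N) a (fun i => if f i then (N : ℝ) else 0) ^ 2 =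
      (∑ i, (a i - ctr d N i) * boolSign (f i)) ^ 2 /
        ((∑ i, (a i - ctr d N i) ^ 2) * d) := by
  have hN' : ((N : ℝ) / 2) ^ 2 ≠ 0 := by positivity
  rw [cosAngleAt, div_pow, mul_pow, dE_vertex_ctr_sq, dE,
    Real.sq_sqrt (Finset.sum_nonneg fun _ _ => sq_nonneg _)]
  simp_rw [vertex_sub_ctr, ← mul_assoc]
  rw [← Finset.sum_mul, mul_pow, mul_div_mul_right _ _ hN']

/-- The mean square of `cos θ_v` over the vertices is at most `1 / d`. -/
theorem sum_cosAngleAt_sq_le {d N : ℕ} (hN : 1 ≤ N) (a : Fin d → ℝ) :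
    ∑ v ∈ cubeV d N, cosAngleAt (ctr d N) a v ^ 2 ≤ 2 ^ d / d := by
  rw [cubeV, Finset.sum_image (cubeV_map_injective d hN).injOn]
  simp_rw [cosAngleAt_vertex_sq hN]
  rw [← Finset.sum_div, sum_sq_sum_mul_boolSign, Fintype.card_fin]
  rcases eq_or_ne (∑ i, (a i - ctr d N i) ^ 2) 0 with h | h
  · rw [h]
    simp only [mul_zero, zero_mul, div_zero]
    positivity
  · rw [mul_comm, mul_div_mul_left _ _ h]

/-- Chebyshev's inequality for a finite set with the uniform measure. -/
theorem card_sub_le_pcount_abs_le {α : Type*} (s : Finset α) (g : α → ℝ) {t : ℝ} (ht : 0 < t) :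
    (s.card : ℝ) - (∑ x ∈ s, g x ^ 2) / t ^ 2 ≤ pcount s (fun x => |g x| ≤ t) := by
  classical
  have hsplit : (pcount s (fun x => |g x| ≤ t) : ℝ) +
      (s.filter fun x => ¬ |g x| ≤ t).card = s.card := by
    rw [pcount, ← Finset.card_filter_add_card_filter_not (s := s) (fun x => |g x| ≤ t)]
    push_cast
    congr!
  have hbad : ((s.filter fun x => ¬ |g x| ≤ t).card : ℝ) ≤ (∑ x ∈ s, g x ^ 2) / t ^ 2 := by
    rw [le_div_iff₀ (by positivity), ← nsmul_eq_mul]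
    refine (Finset.card_nsmul_le_sum _ (fun x => g x ^ 2) _ fun x hx => ?_).trans
      (Finset.sum_le_sum_of_subset_of_nonneg (Finset.filter_subset _ _)
        fun _ _ _ => sq_nonneg _)
    rw [← sq_abs (g x)]
    have := (Finset.mem_filter.1 hx).2
    push Not at this
    gcongr
  linarith

theorem stmt8 (η : ℝ) (hη : η ∈ Set.Ioo (0 : ℝ) (1 / 2)) (d : ℕ)
    (hd : (2 : ℝ) ^ (1 / η) < (d : ℝ)) (γ : ℝ)
    (hγ : γ ∈ Set.Ioc (0 : ℝ) (η - Real.log 2 / Real.log d)) (N : ℕ) (hN : 1 ≤ N)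
    (a : Fin d → ℝ) (ha : a ∈ cubeW d N)
    (har : (d : ℝ) ^ (γ - η) ≤ dn d N a (ctr d N)) :
    (1 : ℝ) - 1 / (d : ℝ) ^ ((1 : ℝ) - 2 * η) ≤
      (pcount (cubeV d N)
          (fun v => |cosAngleAt (ctr d N) a v| ≤ (Real.sqrt 2 + 1) * (d : ℝ) ^ (-γ)) : ℝ) /
        (cubeV d N).card := by
  have hd1 : (1 : ℝ) < d := (Real.one_lt_rpow one_lt_two (one_div_pos.2 hη.1)).trans hd
  have hd0 : (0 : ℝ) < d := one_pos.trans hd1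
  have hγη : γ ≤ η := hγ.2.trans
    (sub_le_self _ (div_nonneg (Real.log_nonneg one_le_two) (Real.log_nonneg hd1.le)))
  set t : ℝ := (Real.sqrt 2 + 1) * (d : ℝ) ^ (-γ)
  have hηt : (d : ℝ) ^ (-η) ≤ t := by
    calc (d : ℝ) ^ (-η) ≤ (d : ℝ) ^ (-γ) :=
          Real.rpow_le_rpow_of_exponent_le hd1.le (neg_le_neg hγη)
      _ ≤ t := le_mul_of_one_le_left (by positivity) (by linarith [Real.sqrt_nonneg 2])
  have hη0 : 0 < (d : ℝ) ^ (-η) := by positivity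
  have ht : 0 < t := hη0.trans_le hηt
  have hpow : (d : ℝ) ^ (1 - 2 * η) = d * ((d : ℝ) ^ (-η)) ^ 2 := by
    rw [← Real.rpow_mul_natCast hd0.le, ← Real.rpow_one_add' hd0.le]
    · congr 1
      push_cast
      ring
    · push_cast
      linarith [hη.2]
  have hsum : (∑ v ∈ cubeV d N, cosAngleAt (ctr d N) a v ^ 2) / t ^ 2 ≤
      2 ^ d / (d : ℝ) ^ (1 - 2 * η) := by
    rw [hpow, ← div_div]
    gcongr
    exact sum_cosAngleAt_sq_le hN a
  have hcheb := card_sub_le_pcount_abs_le (cubeV d N) (cosAngleAt (ctr d N) a) ht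
  rw [card_cubeV d hN] at hcheb ⊢
  push_cast at hcheb ⊢
  rw [le_div_iff₀ (by positivity), sub_mul, one_mul, div_mul_eq_mul_div, one_mul]
  linarith
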